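/- Remaining commutation relations of the symmetry algebra of the barotropic vorticity equation: let 𝒳(f), 𝒵(g), ∂_t, ∂_y be the first-order differential operators defined in the context, acting on smooth functions F : ℝ⁴ → ℝ. Then for every smooth F : ℝ⁴ → ℝ and all smooth f, f̂, g, ĝ : ℝ → ℝ: (i) ∂_t(𝒳(f) F) − 𝒳(f)(∂_t F) = 𝒳(f′) F; (ii) ∂_t(𝒵(g) F) − 𝒵(g)(∂_t F) = 𝒵(g′) F; (iii) ∂_y(𝒳(f) F) − 𝒳(f)(∂_y F) = −𝒵(f′) F; and the following commutators vanish: ∂_y(𝒵(g) F) − 𝒵(g)(∂_y F) = 0, 𝒳(f)(𝒳(f̂) F) − 𝒳(f̂)(𝒳(f) F) = 0, 𝒳(f)(𝒵(g) F) − 𝒵(g)(𝒳(f) F) = 0, 𝒵(g)(𝒵(ĝ) F) − 𝒵(ĝ)(𝒵(g) F) = 0. -/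

import Mathlib

noncomputable section

/-- Partial derivative of `F : ℝ⁴ → ℝ` with respect to the `i`-th coordinate. -/
def pd (i : Fin 4) (F : (Fin 4 → ℝ) → ℝ) (p : Fin 4 → ℝ) : ℝ :=
  fderiv ℝ F p (Pi.single i 1)

/-- The generator `𝒳(f) = f(t)∂_x − f′(t)y∂_ψ` acting on functions of `(t, x, y, ψ)`. -/
def Xop (f : ℝ → ℝ) (F : (Fin 4 → ℝ) → ℝ) (p : Fin 4 → ℝ) : ℝ :=
  f (p 0) * pd 1 F p - deriv f (p 0) * p 2 * pd 3 F p

/-- The generator `𝒵(g) = g(t)∂_ψ` acting on functions of `(t, x, y, ψ)`. -/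
def Zop (g : ℝ → ℝ) (F : (Fin 4 → ℝ) → ℝ) (p : Fin 4 → ℝ) : ℝ :=
  g (p 0) * pd 3 F p

/-- Partial derivatives of a smooth function are smooth. -/
theorem contDiff_pd {F : (Fin 4 → ℝ) → ℝ} (hF : ContDiff ℝ (⊤ : ℕ∞) F) (i : Fin 4) :
    ContDiff ℝ (⊤ : ℕ∞) (pd i F) :=
  (hF.fderiv_right (m := (⊤ : ℕ∞)) (by simp)).clm_apply contDiff_const

/-- Partial derivatives of a smooth function commute. -/
theorem pd_comm {F : (Fin 4 → ℝ) → ℝ} (hF : ContDiff ℝ (⊤ : ℕ∞) F) (i j : Fin 4)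
    (p : Fin 4 → ℝ) : pd i (pd j F) p = pd j (pd i F) p := by
  have hd : DifferentiableAt ℝ (fderiv ℝ F) p :=
    (hF.fderiv_right (m := (⊤ : ℕ∞)) (by simp)).differentiable (by simp) p
  have key (k l : Fin 4) :
      pd k (pd l F) p = fderiv ℝ (fderiv ℝ F) p (Pi.single k 1) (Pi.single l 1) := by
    change fderiv ℝ (fun q => fderiv ℝ F q (Pi.single l 1)) p (Pi.single k 1) = _
    rw [fderiv_clm_apply hd (differentiableAt_const _)]
    simp
  rw [key, key]
  have h2 : (2 : WithTop ℕ∞) ≤ ((⊤ : ℕ∞) : WithTop ℕ∞) :=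
    WithTop.coe_le_coe.2 (le_top (a := (2 : ℕ∞)))
  exact (hF.contDiffAt.isSymmSndFDerivAt (by simpa using h2)) _ _

theorem pd_mul {u v : (Fin 4 → ℝ) → ℝ} {p : Fin 4 → ℝ} (i : Fin 4)
    (hu : DifferentiableAt ℝ u p) (hv : DifferentiableAt ℝ v p) :
    pd i (fun q => u q * v q) p = u p * pd i v p + pd i u p * v p := by
  simp [pd, fderiv_fun_mul hu hv, mul_comm]

theorem pd_sub {u v : (Fin 4 → ℝ) → ℝ} {p : Fin 4 → ℝ} (i : Fin 4)
    (hu : DifferentiableAt ℝ u p) (hv : DifferentiableAt ℝ v p) :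
    pd i (fun q => u q - v q) p = pd i u p - pd i v p := by
  simp [pd, fderiv_fun_sub hu hv]

/-- The partial derivatives of a coordinate function. -/
theorem pd_apply (i j : Fin 4) (p : Fin 4 → ℝ) :
    pd i (fun q => q j) p = (Pi.single i 1 : Fin 4 → ℝ) j := by
  simp [pd, fderiv_apply]

/-- The partial derivatives of a function of the time variable only. -/
theorem pd_comp_time {c : ℝ → ℝ} {p : Fin 4 → ℝ} (i : Fin 4) (hc : DifferentiableAt ℝ c (p 0)) :
    pd i (fun q => c (q 0)) p = deriv c (p 0) * (Pi.single i 1 : Fin 4 → ℝ) 0 := by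
  have h := hc.hasDerivAt.comp_hasFDerivAt p (hasFDerivAt_apply (𝕜 := ℝ) (0 : Fin 4) p)
  change fderiv ℝ (c ∘ fun q : Fin 4 → ℝ => q 0) p (Pi.single i 1) = _
  rw [h.fderiv]
  simp

theorem pd_Zop {F : (Fin 4 → ℝ) → ℝ} (hF : ContDiff ℝ (⊤ : ℕ∞) F) {g : ℝ → ℝ}
    (hg : ContDiff ℝ (⊤ : ℕ∞) g) (i : Fin 4) (p : Fin 4 → ℝ) :
    pd i (Zop g F) p =
      g (p 0) * pd i (pd 3 F) p +
        deriv g (p 0) * (Pi.single i 1 : Fin 4 → ℝ) 0 * pd 3 F p := by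
  have hgd : Differentiable ℝ g := hg.differentiable (by simp)
  have h3 : Differentiable ℝ (pd 3 F) := (contDiff_pd hF 3).differentiable (by simp)
  change pd i (fun q => g (q 0) * pd 3 F q) p = _
  rw [pd_mul i (by fun_prop) (by fun_prop), pd_comp_time i (hgd _)]

theorem pd_Xop {F : (Fin 4 → ℝ) → ℝ} (hF : ContDiff ℝ (⊤ : ℕ∞) F) {f : ℝ → ℝ}
    (hf : ContDiff ℝ (⊤ : ℕ∞) f) (i : Fin 4) (p : Fin 4 → ℝ) :
    pd i (Xop f F) p =
      f (p 0) * pd i (pd 1 F) p + deriv f (p 0) * (Pi.single i 1 : Fin 4 → ℝ) 0 * pd 1 F p -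
        (deriv f (p 0) * p 2 * pd i (pd 3 F) p +
          (deriv f (p 0) * (Pi.single i 1 : Fin 4 → ℝ) 2 +
            deriv (deriv f) (p 0) * (Pi.single i 1 : Fin 4 → ℝ) 0 * p 2) * pd 3 F p) := by
  have hfd : Differentiable ℝ f := hf.differentiable (by simp)
  have hfd' : Differentiable ℝ (deriv f) :=
    (contDiff_infty_iff_deriv.1 hf).2.differentiable (by simp)
  have h1 : Differentiable ℝ (pd 1 F) := (contDiff_pd hF 1).differentiable (by simp)
  have h3 : Differentiable ℝ (pd 3 F) := (contDiff_pd hF 3).differentiable (by simp)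
  change pd i (fun q => f (q 0) * pd 1 F q - deriv f (q 0) * q 2 * pd 3 F q) p = _
  rw [pd_sub i (by fun_prop) (by fun_prop), pd_mul i (by fun_prop) (by fun_prop),
    pd_mul (u := fun q => deriv f (q 0) * q 2) i (by fun_prop) (by fun_prop),
    pd_mul i (by fun_prop) (by fun_prop), pd_comp_time i (hfd _), pd_comp_time i (hfd' _),
    pd_apply]

/-- The remaining commutation relations of the maximal Lie invariance algebra of the barotropic
vorticity equation: `[∂_t, 𝒳(f)] = 𝒳(f′)`, `[∂_t, 𝒵(g)] = 𝒵(g′)`, `[∂_y, 𝒳(f)] = −𝒵(f′)`, and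
`[∂_y, 𝒵(g)] = [𝒳(f), 𝒳(f̂)] = [𝒳(f), 𝒵(g)] = [𝒵(g), 𝒵(ĝ)] = 0`. -/
theorem vorticity_remaining_commutation_relations
    (F : (Fin 4 → ℝ) → ℝ) (hF : ContDiff ℝ (⊤ : ℕ∞) F)
    (f fh g gh : ℝ → ℝ) (hf : ContDiff ℝ (⊤ : ℕ∞) f) (hfh : ContDiff ℝ (⊤ : ℕ∞) fh)
    (hg : ContDiff ℝ (⊤ : ℕ∞) g) (hgh : ContDiff ℝ (⊤ : ℕ∞) gh) :
    (∀ p, pd 0 (Xop f F) p - Xop f (pd 0 F) p = Xop (deriv f) F p) ∧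
    (∀ p, pd 0 (Zop g F) p - Zop g (pd 0 F) p = Zop (deriv g) F p) ∧
    (∀ p, pd 2 (Xop f F) p - Xop f (pd 2 F) p = -Zop (deriv f) F p) ∧
    (∀ p, pd 2 (Zop g F) p - Zop g (pd 2 F) p = 0) ∧
    (∀ p, Xop f (Xop fh F) p - Xop fh (Xop f F) p = 0) ∧
    (∀ p, Xop f (Zop g F) p - Zop g (Xop f F) p = 0) ∧
    (∀ p, Zop g (Zop gh F) p - Zop gh (Zop g F) p = 0) := by
  refine ⟨fun p => ?_, fun p => ?_, fun p => ?_, fun p => ?_, fun p => ?_, fun p => ?_,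
    fun p => ?_⟩
  · rw [pd_Xop hF hf, Xop, Xop, pd_comm hF 0 1, pd_comm hF 0 3]
    simp
    ring
  · rw [pd_Zop hF hg, Zop, Zop, pd_comm hF 0 3]
    simp
  · rw [pd_Xop hF hf, Xop, Zop, pd_comm hF 2 1, pd_comm hF 2 3]
    simp
  · rw [pd_Zop hF hg, Zop, pd_comm hF 2 3]
    simp
  · rw [Xop, Xop, pd_Xop hF hf, pd_Xop hF hf, pd_Xop hF hfh, pd_Xop hF hfh, pd_comm hF 3 1]
    simp
    ring
  · rw [Xop, Zop, pd_Xop hF hf, pd_Zop hF hg, pd_Zop hF hg, pd_comm hF 3 1]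
    simp
    ring
  · rw [Zop, Zop, pd_Zop hF hg, pd_Zop hF hgh]
    simp
    ring

end
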